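/- Let Ω ⊆ ℝ^N be a domain whose boundary Γ is nonempty and satisfies Γ = ∂(ℝ^N \ Ω̄), let 1 < p < ∞, and let u be a bounded viscosity solution of problem (P) in Ω with 0 < u < 1 on Ω×(0,∞). Then for every x ∈ Ω̄, lim_{t→0⁺} 4t·log u(x,t) = −p'·d_Γ(x)². -/

import Mathlib

open MeasureTheory Metric Set Filter
open scoped Topology ENNReal NNReal Real Classical

noncomputable section

/-- The Hessian matrix of a real-valued function, via the second iterated Fréchet derivative. -/
noncomputable def hess {N : ℕ} (f : EuclideanSpace ℝ (Fin N) → ℝ) (x : EuclideanSpace ℝ (Fin N)) :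
    Matrix (Fin N) (Fin N) ℝ :=
  fun i j => iteratedFDeriv ℝ 2 f x ![EuclideanSpace.single i 1, EuclideanSpace.single j 1]

/-- The quadratic form ⟨Xv, v⟩ associated to a matrix. -/
noncomputable def qform {N : ℕ} (X : Matrix (Fin N) (Fin N) ℝ) (v : EuclideanSpace ℝ (Fin N)) : ℝ :=
  ∑ i, ∑ j, X i j * v j * v i

/-- Smallest eigenvalue (via the Rayleigh quotient) of a symmetric matrix. -/
noncomputable def lamMin {N : ℕ} (X : Matrix (Fin N) (Fin N) ℝ) : ℝ :=
  sInf {r | ∃ v : EuclideanSpace ℝ (Fin N), ‖v‖ = 1 ∧ r = qform X v}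

/-- Largest eigenvalue (via the Rayleigh quotient) of a symmetric matrix. -/
noncomputable def lamMax {N : ℕ} (X : Matrix (Fin N) (Fin N) ℝ) : ℝ :=
  sSup {r | ∃ v : EuclideanSpace ℝ (Fin N), ‖v‖ = 1 ∧ r = qform X v}

/-- F(ξ, X) = (1/p)[tr X + (p−2)⟨Xξ,ξ⟩/|ξ|²]. -/
noncomputable def Fop {N : ℕ} (p : ℝ) (ξ : EuclideanSpace ℝ (Fin N))
    (X : Matrix (Fin N) (Fin N) ℝ) : ℝ :=
  (1/p) * (Matrix.trace X + (p - 2) * qform X ξ / ‖ξ‖^2)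

/-- Lower semicontinuous relaxation F_*. -/
noncomputable def Flower {N : ℕ} (p : ℝ) (ξ : EuclideanSpace ℝ (Fin N))
    (X : Matrix (Fin N) (Fin N) ℝ) : ℝ :=
  if ξ = 0 then
    (1/p) * (Matrix.trace X + max (p - 2) 0 * lamMin X + min (p - 2) 0 * lamMax X)
  else Fop p ξ X

/-- Upper semicontinuous relaxation F^*. -/
noncomputable def Fupper {N : ℕ} (p : ℝ) (ξ : EuclideanSpace ℝ (Fin N))
    (X : Matrix (Fin N) (Fin N) ℝ) : ℝ :=
  if ξ = 0 then
    (1/p) * (Matrix.trace X + min (p - 2) 0 * lamMin X + max (p - 2) 0 * lamMax X)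
  else Fop p ξ X

/-- Viscosity solution of `u_t = Δ_p^G u` in `Ω × (0,∞)`. -/
def IsViscositySol {N : ℕ} (p : ℝ) (Ω : Set (EuclideanSpace ℝ (Fin N)))
    (u : EuclideanSpace ℝ (Fin N) → ℝ → ℝ) : Prop :=
  ContinuousOn (fun q : EuclideanSpace ℝ (Fin N) × ℝ => u q.1 q.2) (Ω ×ˢ Set.Ioi 0) ∧
  (∀ φ : EuclideanSpace ℝ (Fin N) × ℝ → ℝ, ContDiff ℝ 2 φ →
    ∀ x ∈ Ω, ∀ t ∈ Set.Ioi (0:ℝ),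
      IsLocalMaxOn (fun q : EuclideanSpace ℝ (Fin N) × ℝ => u q.1 q.2 - φ q)
        (Ω ×ˢ Set.Ioi 0) (x, t) →
      deriv (fun s => φ (x, s)) t ≤
        Fupper p (gradient (fun y => φ (y, t)) x) (hess (fun y => φ (y, t)) x)) ∧
  (∀ φ : EuclideanSpace ℝ (Fin N) × ℝ → ℝ, ContDiff ℝ 2 φ →
    ∀ x ∈ Ω, ∀ t ∈ Set.Ioi (0:ℝ),
      IsLocalMinOn (fun q : EuclideanSpace ℝ (Fin N) × ℝ => u q.1 q.2 - φ q)
        (Ω ×ˢ Set.Ioi 0) (x, t) →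
      Flower p (gradient (fun y => φ (y, t)) x) (hess (fun y => φ (y, t)) x) ≤
        deriv (fun s => φ (x, s)) t)

/-- Bounded (viscosity) solution of problem (P): `u_t = Δ_p^G u` in `Ω × (0,∞)`,
`u = 0` on `Ω × {0}`, `u = 1` on `Γ × (0,∞)`; continuous away from `Γ × {0}`. -/
def IsSolP {N : ℕ} (p : ℝ) (Ω : Set (EuclideanSpace ℝ (Fin N)))
    (u : EuclideanSpace ℝ (Fin N) → ℝ → ℝ) : Prop :=
  (∃ M : ℝ, ∀ x ∈ closure Ω, ∀ t : ℝ, 0 ≤ t → |u x t| ≤ M) ∧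
  (∀ x ∈ closure Ω, ∀ t : ℝ, 0 ≤ t → ¬(x ∈ frontier Ω ∧ t = 0) →
    ContinuousWithinAt (fun q : EuclideanSpace ℝ (Fin N) × ℝ => u q.1 q.2)
      (closure Ω ×ˢ Set.Ici 0) (x, t)) ∧
  IsViscositySol p Ω u ∧
  (∀ x ∈ Ω, u x 0 = 0) ∧
  (∀ y ∈ frontier Ω, ∀ t : ℝ, 0 < t → u y t = 1)

/-- Viscosity solution of the elliptic equation `u − ε² Δ_p^G u = 0` in `Ω`. -/
def IsEllipticViscositySol {N : ℕ} (p ε : ℝ) (Ω : Set (EuclideanSpace ℝ (Fin N)))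
    (u : EuclideanSpace ℝ (Fin N) → ℝ) : Prop :=
  ContinuousOn u Ω ∧
  (∀ φ : EuclideanSpace ℝ (Fin N) → ℝ, ContDiff ℝ 2 φ → ∀ x ∈ Ω,
      IsLocalMaxOn (fun y => u y - φ y) Ω x →
      φ x - ε^2 * Fupper p (gradient φ x) (hess φ x) ≤ 0) ∧
  (∀ φ : EuclideanSpace ℝ (Fin N) → ℝ, ContDiff ℝ 2 φ → ∀ x ∈ Ω,
      IsLocalMinOn (fun y => u y - φ y) Ω x →
      0 ≤ φ x - ε^2 * Flower p (gradient φ x) (hess φ x))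

/-- The complementary error function. -/
noncomputable def Erfc (σ : ℝ) : ℝ := (2 / Real.sqrt π) * ∫ τ in Set.Ioi σ, Real.exp (-τ^2)

/-- The explicit radially symmetric solution `u^ε` of the elliptic problem in the ball `B_R`. -/
noncomputable def uEps (N : ℕ) (p R ε : ℝ) (x : EuclideanSpace ℝ (Fin N)) : ℝ :=
  (∫ θ in (0:ℝ)..π,
      Real.exp (Real.sqrt (p/(p-1)) * (‖x‖/ε) * Real.cos θ) * (Real.sin θ) ^ (((N:ℝ) - p)/(p-1))) /
  (∫ θ in (0:ℝ)..π,
      Real.exp (Real.sqrt (p/(p-1)) * (R/ε) * Real.cos θ) * (Real.sin θ) ^ (((N:ℝ) - p)/(p-1)))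

section Radial

variable {N : ℕ}

theorem hasFDerivAt_radial {G : ℝ → ℝ} {g : ℝ} (a y : EuclideanSpace ℝ (Fin N))
    (hG : HasDerivAt G g (‖y - a‖ ^ 2)) :
    HasFDerivAt (fun y => G (‖y - a‖ ^ 2)) ((2 * g) • innerSL ℝ (y - a)) y := by
  refine (hG.comp_hasFDerivAt y ((hasFDerivAt_id y).sub_const a).norm_sq).congr_fderiv ?_
  ext v
  simp [innerSL_apply_apply]
  ring

theorem gradient_radial {G : ℝ → ℝ} {g : ℝ} (a y : EuclideanSpace ℝ (Fin N))
    (hG : HasDerivAt G g (‖y - a‖ ^ 2)) :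
    gradient (fun y => G (‖y - a‖ ^ 2)) y = (2 * g) • (y - a) := by
  refine HasGradientAt.gradient ?_
  rw [hasGradientAt_iff_hasFDerivAt]
  refine (hasFDerivAt_radial a y hG).congr_fderiv ?_
  ext v
  simp [innerSL_apply_apply]

theorem hess_radial {G g : ℝ → ℝ} {g' : ℝ} (a y : EuclideanSpace ℝ (Fin N))
    (hG : ∀ s, 0 ≤ s → HasDerivAt G (g s) s) (hg : HasDerivAt g g' (‖y - a‖ ^ 2)) (i j : Fin N) :
    hess (fun y => G (‖y - a‖ ^ 2)) y i j =
      (if i = j then 2 * g (‖y - a‖ ^ 2) else 0) + 4 * g' * (y - a) i * (y - a) j := by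
  have h1 : fderiv ℝ (fun y => G (‖y - a‖ ^ 2)) =
      fun y => (2 * g (‖y - a‖ ^ 2)) • innerSL ℝ (y - a) := by
    funext z
    exact (hasFDerivAt_radial a z (hG _ (by positivity))).fderiv
  have h2 : HasFDerivAt (fun y => (2 * g (‖y - a‖ ^ 2)) • innerSL ℝ (y - a)) _ y :=
    ((hasFDerivAt_radial a y hg).const_mul 2).smul
      ((innerSL ℝ (E := EuclideanSpace ℝ (Fin N))).hasFDerivAt.comp y
        ((hasFDerivAt_id y).sub_const a))
  rw [hess, iteratedFDeriv_two_apply, h1, h2.fderiv]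
  change (2 * g (‖y - a‖ ^ 2)) *
        inner ℝ (EuclideanSpace.single i (1 : ℝ)) (EuclideanSpace.single j (1 : ℝ)) +
      (2 * ((2 * g') * inner ℝ (y - a) (EuclideanSpace.single i (1 : ℝ)))) *
        inner ℝ (y - a) (EuclideanSpace.single j (1 : ℝ)) = _
  simp only [EuclideanSpace.inner_single_right, PiLp.single_apply, eq_comm (a := j),
    conj_trivial]
  split_ifs <;> ring

/-- A matrix of the form `α I + β w ⊗ w`. -/
def rankOnePerturb (α β : ℝ) (w : EuclideanSpace ℝ (Fin N)) : Matrix (Fin N) (Fin N) ℝ :=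
  fun i j => (if i = j then α else 0) + β * w i * w j

theorem trace_rankOnePerturb (α β : ℝ) (w : EuclideanSpace ℝ (Fin N)) :
    Matrix.trace (rankOnePerturb α β w) = N * α + β * ‖w‖ ^ 2 := by
  simp only [Matrix.trace, Matrix.diag, rankOnePerturb, if_true, Finset.sum_add_distrib,
    EuclideanSpace.real_norm_sq_eq, Finset.mul_sum]
  congr 1
  · simp
  · exact Finset.sum_congr rfl fun i _ => by ring

theorem qform_rankOnePerturb (α β : ℝ) (w v : EuclideanSpace ℝ (Fin N)) :
    qform (rankOnePerturb α β w) v = α * ‖v‖ ^ 2 + β * (∑ i, w i * v i) ^ 2 := by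
  simp only [qform, rankOnePerturb, add_mul, Finset.sum_add_distrib, ite_mul, zero_mul,
    Finset.sum_ite_eq, Finset.mem_univ, if_true, EuclideanSpace.real_norm_sq_eq]
  congr 1
  · rw [Finset.mul_sum]
    exact Finset.sum_congr rfl fun i _ => by ring
  · rw [sq, Finset.sum_mul_sum, Finset.mul_sum]
    refine Finset.sum_congr rfl fun i _ => ?_
    rw [Finset.mul_sum]
    exact Finset.sum_congr rfl fun j _ => by ring

theorem setOf_qform_scalar (hN : 2 ≤ N) (α β : ℝ) :
    {r | ∃ v : EuclideanSpace ℝ (Fin N), ‖v‖ = 1 ∧ r = qform (rankOnePerturb α β 0) v} = {α} := by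
  ext r
  simp only [qform_rankOnePerturb, mem_ofPred_eq, mem_singleton_iff]
  constructor
  · rintro ⟨v, hv, rfl⟩
    simp [hv]
  · rintro rfl
    exact ⟨EuclideanSpace.single ⟨0, by omega⟩ 1, by simp, by simp⟩

theorem Fop_radial {p α β : ℝ} {w : EuclideanSpace ℝ (Fin N)} (hα : α ≠ 0) (hw : w ≠ 0) :
    Fop p (α • w) (rankOnePerturb α β w) =
      (1 / p) * ((N + p - 2) * α + (p - 1) * β * ‖w‖ ^ 2) := by
  have hw' : ‖w‖ ^ 2 ≠ 0 := by simpa using hw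
  have hs : ∑ i, w i * (α • w) i = α * ‖w‖ ^ 2 := by
    rw [EuclideanSpace.real_norm_sq_eq, Finset.mul_sum]
    exact Finset.sum_congr rfl fun i _ => by simp; ring
  have hq : qform (rankOnePerturb α β w) (α • w) / ‖α • w‖ ^ 2 = α + β * ‖w‖ ^ 2 := by
    rw [qform_rankOnePerturb, hs, norm_smul, mul_pow, Real.norm_eq_abs, sq_abs]
    field_simp
  rw [Fop, trace_rankOnePerturb, mul_div_assoc, hq]
  ring

theorem Fupper_radial (hN : 2 ≤ N) {p α β : ℝ} {w : EuclideanSpace ℝ (Fin N)} (hα : α ≠ 0) :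
    Fupper p (α • w) (rankOnePerturb α β w) =
      (1 / p) * ((N + p - 2) * α + (p - 1) * β * ‖w‖ ^ 2) := by
  by_cases hw : w = 0
  · subst hw
    rw [Fupper, if_pos (smul_zero _), lamMin, lamMax, setOf_qform_scalar hN, csInf_singleton,
      csSup_singleton, trace_rankOnePerturb, norm_zero]
    linear_combination (1 / p) * α * (min_add_max (p - 2) 0)
  · rw [Fupper, if_neg (smul_ne_zero hα hw), Fop_radial hα hw]

theorem Flower_radial {p α β : ℝ} {w : EuclideanSpace ℝ (Fin N)} (hα : α ≠ 0) (hw : w ≠ 0) :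
    Flower p (α • w) (rankOnePerturb α β w) =
      (1 / p) * ((N + p - 2) * α + (p - 1) * β * ‖w‖ ^ 2) := by
  rw [Flower, if_neg (smul_ne_zero hα hw), Fop_radial hα hw]

theorem hess_radial_eq {G g : ℝ → ℝ} {g' : ℝ} (a y : EuclideanSpace ℝ (Fin N))
    (hG : ∀ s, 0 ≤ s → HasDerivAt G (g s) s) (hg : HasDerivAt g g' (‖y - a‖ ^ 2)) :
    hess (fun y => G (‖y - a‖ ^ 2)) y =
      rankOnePerturb (2 * g (‖y - a‖ ^ 2)) (4 * g') (y - a) := by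
  ext i j
  exact hess_radial a y hG hg i j

end Radial

section UpperBarrier

variable {N : ℕ}

theorem hasDerivAt_exp_sqrt {δ : ℝ} (hδ : 0 < δ) (k c : ℝ) {s : ℝ} (hs : 0 ≤ s) :
    HasDerivAt (fun s => Real.exp (c + k * √(δ ^ 2 + s)))
      (k / 2 * (√(δ ^ 2 + s))⁻¹ * Real.exp (c + k * √(δ ^ 2 + s))) s := by
  have hpos : 0 < δ ^ 2 + s := by positivity
  have h := (((((hasDerivAt_id' s).const_add (δ ^ 2)).sqrt hpos.ne').const_mul k).const_add c).exp
  convert h using 1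
  ring

theorem hasDerivAt_deriv_exp_sqrt {δ : ℝ} (hδ : 0 < δ) (k c : ℝ) {s : ℝ} (hs : 0 ≤ s) :
    HasDerivAt (fun s => k / 2 * (√(δ ^ 2 + s))⁻¹ * Real.exp (c + k * √(δ ^ 2 + s)))
      ((k ^ 2 / √(δ ^ 2 + s) ^ 2 - k / √(δ ^ 2 + s) ^ 3) / 4 *
        Real.exp (c + k * √(δ ^ 2 + s))) s := by
  have hpos : 0 < δ ^ 2 + s := by positivity
  have hq : 0 < √(δ ^ 2 + s) := Real.sqrt_pos.2 hpos
  refine ((((((hasDerivAt_id' s).const_add (δ ^ 2)).sqrt hpos.ne').fun_inv hq.ne').const_mul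
    (k / 2)).fun_mul (hasDerivAt_exp_sqrt hδ k c hs)).congr_deriv ?_
  field_simp
  ring

/-- `exp (l t + k (√(δ² + |y - a|²) - R))` is a strict supersolution for `l` large. -/
theorem Fupper_exp_sqrt_lt (hN : 2 ≤ N) {p : ℝ} (hp : 1 < p) {δ k : ℝ} (hδ : 0 < δ) (hk : 0 < k)
    (c : ℝ) (a y : EuclideanSpace ℝ (Fin N)) :
    Fupper p (gradient (fun y => Real.exp (c + k * √(δ ^ 2 + ‖y - a‖ ^ 2))) y)
        (hess (fun y => Real.exp (c + k * √(δ ^ 2 + ‖y - a‖ ^ 2))) y) <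
      (k ^ 2 * ((p - 1) / p) + k * ((N + p - 2) / (p * δ)) + 1) *
        Real.exp (c + k * √(δ ^ 2 + ‖y - a‖ ^ 2)) := by
  have hs : 0 ≤ ‖y - a‖ ^ 2 := by positivity
  have hNr : (2 : ℝ) ≤ N := by exact_mod_cast hN
  rw [gradient_radial (G := fun s => Real.exp (c + k * √(δ ^ 2 + s))) a y
      (hasDerivAt_exp_sqrt hδ k c hs),
    hess_radial_eq (G := fun s => Real.exp (c + k * √(δ ^ 2 + s)))
      (g := fun s => k / 2 * (√(δ ^ 2 + s))⁻¹ * Real.exp (c + k * √(δ ^ 2 + s))) a y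
      (fun s hs => hasDerivAt_exp_sqrt hδ k c hs) (hasDerivAt_deriv_exp_sqrt hδ k c hs)]
  have hsq : √(δ ^ 2 + ‖y - a‖ ^ 2) ^ 2 = δ ^ 2 + ‖y - a‖ ^ 2 := Real.sq_sqrt (by positivity)
  have hδq : δ ≤ √(δ ^ 2 + ‖y - a‖ ^ 2) := Real.le_sqrt_of_sq_le (by linarith)
  set q := √(δ ^ 2 + ‖y - a‖ ^ 2) with hqdef
  have hq : 0 < q := hδ.trans_le hδq
  rw [Fupper_radial hN (by positivity)]
  have hE : 0 < Real.exp (c + k * q) := Real.exp_pos _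
  set E := Real.exp (c + k * q)
  set s := ‖y - a‖ ^ 2
  have e : (1 / p) * ((N + p - 2) * (2 * (k / 2 * q⁻¹ * E)) +
      (p - 1) * (4 * ((k ^ 2 / q ^ 2 - k / q ^ 3) / 4 * E)) * s) =
      (k ^ 2 * ((p - 1) / p) * (s / q ^ 2) + k * ((N + p - 2) / p) * (1 / q) -
        (p - 1) / p * k * s / q ^ 3) * E := by
    field_simp
    ring
  rw [e]
  refine mul_lt_mul_of_pos_right ?_ hE
  have hp1 : 0 < p - 1 := by linarith
  have hp0 : 0 < p := by linarith
  have hNp : 0 < N + p - 2 := by linarith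
  have h1 : k ^ 2 * ((p - 1) / p) * (s / q ^ 2) ≤ k ^ 2 * ((p - 1) / p) :=
    mul_le_of_le_one_right (by positivity) ((div_le_one (by positivity)).2 (by nlinarith))
  have h2 : k * ((N + p - 2) / p) * (1 / q) ≤ k * ((N + p - 2) / p) * (1 / δ) := by
    gcongr
  have h3 : 0 ≤ (p - 1) / p * k * s / q ^ 3 := by positivity
  have h4 : k * ((N + p - 2) / p) * (1 / δ) = k * ((N + p - 2) / (p * δ)) := by
    field_simp
  linarith

theorem le_exp_barrier (hN : 2 ≤ N) {p : ℝ} (hp : 1 < p) {Ω : Set (EuclideanSpace ℝ (Fin N))}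
    (hΩo : IsOpen Ω) {u : EuclideanSpace ℝ (Fin N) → ℝ → ℝ} (hu : IsSolP p Ω u)
    (hlt : ∀ x ∈ Ω, ∀ t : ℝ, 0 < t → u x t < 1) {a : EuclideanSpace ℝ (Fin N)} {R δ k : ℝ}
    (hR : 0 < R) (hδ : 0 < δ) (hk : 0 < k) (hball : closedBall a R ⊆ Ω) {t : ℝ} (ht : 0 < t) :
    u a t ≤ Real.exp ((k ^ 2 * ((p - 1) / p) + k * ((N + p - 2) / (p * δ)) + 1) * t -
      k * (R - δ)) := by
  have hNr : (2 : ℝ) ≤ N := by exact_mod_cast hN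
  have hp1 : 0 < p - 1 := by linarith
  have hp0 : 0 < p := by linarith
  have hNp : 0 < N + p - 2 := by linarith
  obtain ⟨-, hcont, ⟨-, hsub, -⟩, hinit, -⟩ := hu
  set l := k ^ 2 * ((p - 1) / p) + k * ((N + p - 2) / (p * δ)) + 1 with hl
  have hlpos : 0 < l := by positivity
  set w : EuclideanSpace ℝ (Fin N) × ℝ → ℝ := fun q =>
    Real.exp (l * q.2 - k * R + k * √(δ ^ 2 + ‖q.1 - a‖ ^ 2)) with hw
  have hwa : w (a, t) = Real.exp (l * t - k * (R - δ)) := by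
    simp only [hw, sub_self, norm_zero]
    rw [show δ ^ 2 + 0 ^ 2 = δ ^ 2 by ring, Real.sqrt_sq hδ.le]
    congr 1
    ring
  rw [← hwa]
  have hlate : ∀ q : EuclideanSpace ℝ (Fin N) × ℝ, k * R ≤ l * q.2 → 1 ≤ w q := fun q hq =>
    Real.one_le_exp (by have : 0 ≤ k * √(δ ^ 2 + ‖q.1 - a‖ ^ 2) := by positivity
                        linarith)
  have hside : ∀ q : EuclideanSpace ℝ (Fin N) × ℝ, 0 ≤ q.2 → R ≤ ‖q.1 - a‖ → 1 ≤ w q := by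
    intro q hq0 hqR
    refine Real.one_le_exp ?_
    have h1 : R ≤ √(δ ^ 2 + ‖q.1 - a‖ ^ 2) := Real.le_sqrt_of_sq_le (by nlinarith)
    nlinarith [mul_nonneg hlpos.le hq0, mul_le_mul_of_nonneg_left h1 hk.le]
  have hsmooth : ContDiff ℝ 2 w := by
    refine ContDiff.exp (ContDiff.add (by fun_prop) (contDiff_const.mul (ContDiff.sqrt ?_ ?_)))
    · exact contDiff_const.add (ContDiff.norm_sq ℝ (by fun_prop))
    · intro q
      positivity
  by_contra! hcon
  set T := k * R / l with hT
  have htT : t ≤ T := by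
    by_contra! h
    have h1 := hlate (a, t) (by simpa using ((div_lt_iff₀' hlpos).1 h).le)
    exact absurd (hlt a (hball (mem_closedBall_self hR.le)) t ht) (by linarith)
  have hcK : ContinuousOn (fun q : EuclideanSpace ℝ (Fin N) × ℝ => u q.1 q.2 - w q)
      (closedBall a R ×ˢ Icc 0 T) := by
    refine ContinuousOn.sub (fun q hq => ?_) hsmooth.continuous.continuousOn
    have hqΩ := hball hq.1
    refine (hcont q.1 (subset_closure hqΩ) q.2 hq.2.1 fun h => ?_).mono ?_
    · exact (hΩo.inter_frontier_eq.le ⟨hqΩ, h.1⟩ : q.1 ∈ (∅ : Set _))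
    · exact prod_mono (hball.trans subset_closure) Icc_subset_Ici_self
  obtain ⟨⟨x, s⟩, hxs, hmax⟩ := ((isCompact_closedBall a R).prod isCompact_Icc).exists_isMaxOn
    ⟨(a, t), mem_closedBall_self hR.le, ht.le, htT⟩ hcK
  have hpos : w (x, s) < u x s := by
    have h1 : u a t - w (a, t) ≤ u x s - w (x, s) :=
      hmax (a := (a, t)) ⟨mem_closedBall_self hR.le, ht.le, htT⟩
    linarith
  have hxΩ : x ∈ Ω := hball hxs.1
  have hs0 : 0 < s := by
    refine lt_of_le_of_ne hxs.2.1 fun h => ?_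
    subst h
    rw [hinit x hxΩ] at hpos
    exact absurd hpos (Real.exp_pos _).not_gt
  have hu1 := hlt x hxΩ s hs0
  have hsT : s < T := by
    by_contra! h
    have := hlate (x, s) (by simpa using (div_le_iff₀' hlpos).1 h)
    linarith
  have hxR : x ∈ ball a R := by
    rw [mem_ball_iff_norm]
    by_contra! h
    have := hside (x, s) hs0.le h
    linarith
  have hloc : IsLocalMaxOn (fun q : EuclideanSpace ℝ (Fin N) × ℝ => u q.1 q.2 - w q)
      (Ω ×ˢ Ioi 0) (x, s) := by
    refine IsLocalMax.on (Filter.mem_of_superset (prod_mem_nhds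
      (Filter.mem_of_superset (isOpen_ball.mem_nhds hxR) ball_subset_closedBall)
      (Icc_mem_nhds hs0 hsT)) fun q hq => hmax hq) _
  have h1 := hsub w hsmooth x hxΩ s hs0 hloc
  have h2 := Fupper_exp_sqrt_lt hN hp hδ hk (l * s - k * R) a x
  have h3 : deriv (fun s => w (x, s)) s = l * w (x, s) := by
    have h := ((((hasDerivAt_id' s).const_mul l).sub_const (k * R)).add_const
      (k * √(δ ^ 2 + ‖x - a‖ ^ 2))).exp
    rw [HasDerivAt.deriv (f := fun s => w (x, s)) h]
    simp only [hw]
    ring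
  rw [h3] at h1
  exact absurd (h1.trans_lt h2) (lt_irrefl _)

end UpperBarrier

section LowerBarrier

variable {N : ℕ}

theorem exists_contDiff_pos_eventuallyEq_id {t : ℝ} (ht : 0 < t) :
    ∃ g : ℝ → ℝ, ContDiff ℝ 2 g ∧ (∀ s, 0 < g s) ∧ ∀ᶠ s in 𝓝 t, g s = s := by
  set σ : ℝ → ℝ := fun s => Real.smoothTransition (2 * s / t) with hσ
  have h2 : ContDiff ℝ 2 σ :=
    (Real.smoothTransition.contDiff (n := 2)).comp (by fun_prop)
  refine ⟨fun s => σ s * s + (1 - σ s), by fun_prop, fun s => ?_, ?_⟩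
  · rcases le_or_gt s 0 with hs | hs
    · have : σ s = 0 := Real.smoothTransition.zero_of_nonpos
        (div_nonpos_of_nonpos_of_nonneg (by linarith) ht.le)
      simp [this]
    · have h0 : 0 < σ s := Real.smoothTransition.pos_of_pos (by positivity)
      have h1 : σ s ≤ 1 := Real.smoothTransition.le_one _
      nlinarith [mul_pos h0 hs]
  · filter_upwards [lt_mem_nhds (half_lt_self ht)] with s hs
    have : σ s = 1 := Real.smoothTransition.one_of_one_le
      ((one_le_div ht).2 (by linarith))
    simp [this]

theorem pow_mul_exp_neg_le {b τ : ℝ} (hb : 0 < b) (hτ : 0 ≤ τ) (m : ℕ) :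
    τ ^ m * Real.exp (-(b * τ)) ≤ m.factorial / b ^ m := by
  have h := Real.pow_div_factorial_le_exp (b * τ) (by positivity) m
  have hf : (0 : ℝ) < m.factorial := by positivity
  rw [div_le_iff₀ hf, mul_pow] at h
  rw [Real.exp_neg, le_div_iff₀ (by positivity), ← div_eq_mul_inv, div_mul_eq_mul_div,
    div_le_iff₀ (Real.exp_pos _)]
  linarith

/-- The Gaussian `K t⁻ᵐ exp (-p' |y - z|² / (4t))` with `m` large is a strict subsolution away
from its centre. -/
theorem lt_Flower_gaussian {p : ℝ} (hp : 1 < p) {K t m : ℝ} (hK : 0 < K)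
    (ht : 0 < t) (hm : (N + p - 2) / (2 * (p - 1)) < m) {z y : EuclideanSpace ℝ (Fin N)}
    (hyz : y ≠ z) :
    (-(m / t) + p / (p - 1) / 4 * ‖y - z‖ ^ 2 / t ^ 2) *
        (K * Real.exp (-(p / (p - 1) / 4 * ‖y - z‖ ^ 2 * t⁻¹))) <
      Flower p (gradient (fun y => K * Real.exp (-(p / (p - 1) / 4 * ‖y - z‖ ^ 2 * t⁻¹))) y)
        (hess (fun y => K * Real.exp (-(p / (p - 1) / 4 * ‖y - z‖ ^ 2 * t⁻¹))) y) := by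
  have hp1 : 0 < p - 1 := by linarith
  have hp0 : 0 < p := by linarith
  set B := p / (p - 1) / 4 * t⁻¹ with hB
  have hBpos : 0 < B := by positivity
  set G : ℝ → ℝ := fun s => K * Real.exp (-(p / (p - 1) / 4 * s * t⁻¹)) with hG
  have hGd : ∀ s, HasDerivAt G (-B * G s) s := fun s => by
    refine (((((hasDerivAt_id' s).const_mul (p / (p - 1) / 4)).mul_const t⁻¹).fun_neg).exp.const_mul
      K).congr_deriv ?_
    simp only [hG, hB]
    ring
  have hgd : ∀ s, HasDerivAt (fun s => -B * G s) (-B * (-B * G s)) s :=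
    fun s => (hGd s).const_mul _
  have hGpos : 0 < G (‖y - z‖ ^ 2) := by positivity
  change _ * G (‖y - z‖ ^ 2) < Flower p (gradient (fun y => G (‖y - z‖ ^ 2)) y)
    (hess (fun y => G (‖y - z‖ ^ 2)) y)
  rw [gradient_radial z y (hGd _), hess_radial_eq z y (fun s _ => hGd s) (hgd _),
    Flower_radial (by simp [hBpos.ne', hGpos.ne']) (sub_ne_zero.2 hyz)]
  have e : (1 / p) * ((N + p - 2) * (2 * (-B * G (‖y - z‖ ^ 2))) +
      (p - 1) * (4 * (-B * (-B * G (‖y - z‖ ^ 2)))) * ‖y - z‖ ^ 2) =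
      (-((N + p - 2) / (2 * (p - 1)) / t) + p / (p - 1) / 4 * ‖y - z‖ ^ 2 / t ^ 2) *
        G (‖y - z‖ ^ 2) := by
    rw [hB]
    field_simp
    ring
  rw [e]
  gcongr

theorem hasDerivAt_gaussian_time (A b : ℝ) {m : ℕ} (hm : m ≠ 0) {t : ℝ} (ht : t ≠ 0) :
    HasDerivAt (fun s : ℝ => A * s⁻¹ ^ m * Real.exp (-(b * s⁻¹)))
      ((-(m / t) + b / t ^ 2) * (A * t⁻¹ ^ m * Real.exp (-(b * t⁻¹)))) t := by
  have hi := hasDerivAt_inv ht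
  refine (((hi.fun_pow m).const_mul A).fun_mul (hi.const_mul b).fun_neg.exp).congr_deriv ?_
  obtain ⟨n, rfl⟩ := Nat.exists_eq_succ_of_ne_zero hm
  simp only [Nat.succ_eq_add_one, Nat.add_sub_cancel]
  ring

theorem exists_gaussian_le {p : ℝ} (hp : 1 < p) {Ω : Set (EuclideanSpace ℝ (Fin N))}
    {u : EuclideanSpace ℝ (Fin N) → ℝ → ℝ} (hu : IsSolP p Ω u)
    (hpos : ∀ x ∈ Ω, ∀ t : ℝ, 0 < t → 0 < u x t) {z : EuclideanSpace ℝ (Fin N)} {ρ : ℝ}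
    (hρ : 0 < ρ) (hz : ∀ y ∈ closure Ω, ρ ≤ ‖y - z‖) {m : ℕ} (hm0 : m ≠ 0)
    (hm : (N + p - 2) / (2 * (p - 1)) < m) :
    ∃ A > 0, ∀ x ∈ Ω, ∀ t : ℝ, 0 < t →
      A * t⁻¹ ^ m * Real.exp (-(p / (p - 1) / 4 * ‖x - z‖ ^ 2 * t⁻¹)) ≤ u x t := by
  have hp1 : 0 < p - 1 := by linarith
  have hp0 : 0 < p := by linarith
  obtain ⟨-, hcont, ⟨-, -, hsuper⟩, -, hbdry⟩ := hu
  set c := p / (p - 1) / 4 with hc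
  have hcpos : 0 < c := by positivity
  set b : ℝ := c * ρ ^ 2 with hb
  have hbpos : 0 < b := by positivity
  have hb_le : ∀ y ∈ closure Ω, b ≤ c * ‖y - z‖ ^ 2 := fun y hy => by
    have := hz y hy
    rw [hb]
    gcongr
  refine ⟨b ^ m / m.factorial, by positivity, ?_⟩
  set A : ℝ := b ^ m / m.factorial with hA
  have hApos : 0 < A := by positivity
  set v : EuclideanSpace ℝ (Fin N) → ℝ → ℝ := fun y t =>
    A * t⁻¹ ^ m * Real.exp (-(c * ‖y - z‖ ^ 2 * t⁻¹)) with hv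
  have hv_space : ∀ y ∈ closure Ω, ∀ t, 0 < t →
      v y t ≤ A * (m.factorial / (c * ‖y - z‖ ^ 2) ^ m) := fun y hy t ht => by
    simp only [hv, mul_assoc A]
    exact mul_le_mul_of_nonneg_left (pow_mul_exp_neg_le (hbpos.trans_le (hb_le y hy))
      (inv_nonneg.2 ht.le) m) hApos.le
  have hv_one : ∀ y ∈ closure Ω, ∀ t, 0 < t → v y t ≤ 1 := fun y hy t ht => by
    refine (hv_space y hy t ht).trans ?_
    have h1 : A * (m.factorial / b ^ m) = 1 := by
      rw [hA]
      field_simp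
    rw [← h1]
    have := hb_le y hy
    gcongr
  have hv_late : ∀ y t, 0 < t → v y t ≤ A * t⁻¹ ^ m := fun y t ht =>
    mul_le_of_le_one_right (by positivity) (Real.exp_le_one_iff.2 (by
      have : 0 ≤ c * ‖y - z‖ ^ 2 * t⁻¹ := by positivity
      linarith))
  have hv_early : ∀ y ∈ closure Ω, ∀ t, 0 < t →
      v y t ≤ A * ((m + 1).factorial / b ^ (m + 1)) * t := fun y hy t ht => by
    have hby := hb_le y hy
    have h1 := pow_mul_exp_neg_le (hbpos.trans_le hby) (inv_nonneg.2 ht.le) (m + 1)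
    have h2 : v y t = A * (t⁻¹ ^ (m + 1) * Real.exp (-(c * ‖y - z‖ ^ 2 * t⁻¹))) * t := by
      simp only [hv, pow_succ t⁻¹]
      linear_combination (-(A * t⁻¹ ^ m * Real.exp (-(c * ‖y - z‖ ^ 2 * t⁻¹)))) *
        inv_mul_cancel₀ ht.ne'
    rw [h2]
    gcongr
    refine h1.trans ?_
    gcongr
  intro x₁ hx₁ t₁ ht₁
  change v x₁ t₁ ≤ u x₁ t₁
  by_contra! hcon
  set β := v x₁ t₁ - u x₁ t₁ with hβ
  have hβpos : 0 < β := sub_pos.2 hcon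
  have hβv : β < v x₁ t₁ := by linarith [hpos x₁ hx₁ t₁ ht₁]
  set D := A * ((m + 1).factorial / b ^ (m + 1)) with hD
  have hDpos : 0 < D := by positivity
  set L := √((1 + A * m.factorial / β) / c) with hL
  -- where `v` is at least `β`, all variables are confined to a compact set
  have hconf : ∀ y ∈ closure Ω, ∀ t, 0 < t → β ≤ v y t →
      (y, t) ∈ (closure Ω ∩ closedBall z L) ×ˢ Icc (β / D) (1 + A / β) := by
    intro y hy t ht hyt
    refine ⟨⟨hy, ?_⟩, ?_, ?_⟩
    · rw [mem_closedBall_iff_norm]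
      refine Real.le_sqrt_of_sq_le ?_
      rw [le_div_iff₀ hcpos, mul_comm]
      by_contra! h
      have hAm : 0 ≤ A * m.factorial / β := by positivity
      have h1 : (c * ‖y - z‖ ^ 2) ≤ (c * ‖y - z‖ ^ 2) ^ m :=
        le_self_pow₀ (by linarith) hm0
      have h2 := hyt.trans (hv_space y hy t ht)
      have h3 : 0 < c * ‖y - z‖ ^ 2 := by linarith
      rw [← mul_div_assoc, le_div_iff₀ (by positivity)] at h2
      have h4 : A * m.factorial / β < c * ‖y - z‖ ^ 2 := by linarith
      rw [div_lt_iff₀ hβpos] at h4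
      nlinarith
    · rw [div_le_iff₀' hDpos]
      exact hyt.trans (hv_early y hy t ht)
    · by_contra! h
      have hAβ : 0 ≤ A / β := by positivity
      have h1 : t⁻¹ ^ m ≤ t⁻¹ := pow_le_of_le_one (by positivity)
        (inv_le_one_of_one_le₀ (by linarith)) hm0
      have h2 : β ≤ A * t⁻¹ := (hyt.trans (hv_late y t ht)).trans (by gcongr)
      rw [← div_eq_mul_inv, le_div_iff₀ ht, ← le_div_iff₀' hβpos] at h2
      linarith
  have hKpos : ∀ q ∈ (closure Ω ∩ closedBall z L) ×ˢ Icc (β / D) (1 + A / β), 0 < q.2 :=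
    fun q hq => lt_of_lt_of_le (by positivity) hq.2.1
  have hcK : ContinuousOn (fun q : EuclideanSpace ℝ (Fin N) × ℝ => u q.1 q.2 - v q.1 q.2)
      ((closure Ω ∩ closedBall z L) ×ˢ Icc (β / D) (1 + A / β)) := by
    refine ContinuousOn.sub (fun q hq => ?_) ?_
    · refine (hcont q.1 hq.1.1 q.2 (hKpos q hq).le fun h => (hKpos q hq).ne' h.2).mono ?_
      exact fun q hq => ⟨hq.1.1, (hKpos q hq).le⟩
    · have hinv : ContinuousOn (fun q : EuclideanSpace ℝ (Fin N) × ℝ => q.2⁻¹)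
          ((closure Ω ∩ closedBall z L) ×ˢ Icc (β / D) (1 + A / β)) :=
        continuousOn_snd.inv₀ fun q hq => (hKpos q hq).ne'
      simp only [hv]
      fun_prop
  obtain ⟨⟨x, t⟩, hxt, hmin⟩ :=
    (((isCompact_closedBall z L).inter_left isClosed_closure).prod isCompact_Icc).exists_isMinOn
      ⟨(x₁, t₁), hconf x₁ (subset_closure hx₁) t₁ ht₁ hβv.le⟩ hcK
  have hval : u x t - v x t ≤ -β := by
    have h : u x t - v x t ≤ u x₁ t₁ - v x₁ t₁ :=
      hmin (a := (x₁, t₁)) (hconf x₁ (subset_closure hx₁) t₁ ht₁ hβv.le)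
    linarith
  have ht : 0 < t := hKpos _ hxt
  have hxcl : x ∈ closure Ω := hxt.1.1
  have hxΩ : x ∈ Ω := by
    rcases closure_eq_self_union_frontier Ω ▸ hxcl with h | h
    · exact h
    · have h1 := hbdry x h t ht
      have h2 := hv_one x hxcl t ht
      linarith
  have hglob : ∀ q ∈ Ω ×ˢ Ioi (0 : ℝ), u x t - v x t ≤ u q.1 q.2 - v q.1 q.2 := by
    rintro ⟨y, s⟩ ⟨hy, hs⟩
    rcases le_or_gt β (v y s) with h | h
    · exact hmin (hconf y (subset_closure hy) s hs h)
    · have := hpos y hy s hs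
      dsimp only
      linarith
  obtain ⟨g, hgs, hgpos, hgt⟩ := exists_contDiff_pos_eventuallyEq_id ht
  set φ : EuclideanSpace ℝ (Fin N) × ℝ → ℝ := fun q => v q.1 (g q.2) with hφ
  have hφs : ContDiff ℝ 2 φ := by
    have hinv : ContDiff ℝ 2 (fun q : EuclideanSpace ℝ (Fin N) × ℝ => (g q.2)⁻¹) :=
      (hgs.comp contDiff_snd).inv fun q => (hgpos _).ne'
    have hnorm : ContDiff ℝ 2 (fun q : EuclideanSpace ℝ (Fin N) × ℝ => ‖q.1 - z‖ ^ 2) :=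
      ContDiff.norm_sq ℝ (by fun_prop)
    exact (contDiff_const.mul (hinv.pow m)).mul ((contDiff_const.mul hnorm).mul hinv).neg.exp
  have hgt' : ∀ᶠ q : EuclideanSpace ℝ (Fin N) × ℝ in 𝓝 (x, t), g q.2 = q.2 :=
    (continuous_snd.tendsto (x, t)).eventually hgt
  have hloc : IsLocalMinOn (fun q : EuclideanSpace ℝ (Fin N) × ℝ => u q.1 q.2 - φ q)
      (Ω ×ˢ Ioi 0) (x, t) := by
    filter_upwards [mem_nhdsWithin_of_mem_nhds hgt', self_mem_nhdsWithin] with q hq hqΩ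
    simp only [hφ, hq, hgt.self_of_nhds]
    exact hglob q hqΩ
  have h1 := hsuper φ hφs x hxΩ t ht hloc
  have hxz : x ≠ z := by
    rintro rfl
    have := hz x hxcl
    simp at this
    linarith
  have h2 := lt_Flower_gaussian hp (K := A * t⁻¹ ^ m) (by positivity) ht hm hxz
  have h3 : deriv (fun s => φ (x, s)) t =
      (-(m / t) + c * ‖x - z‖ ^ 2 / t ^ 2) *
        (A * t⁻¹ ^ m * Real.exp (-(c * ‖x - z‖ ^ 2 * t⁻¹))) := by
    have he : (fun s => φ (x, s)) =ᶠ[𝓝 t] fun s => v x s := by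
      filter_upwards [hgt] with s hs
      simp only [hφ, hs]
    rw [he.deriv_eq]
    exact (hasDerivAt_gaussian_time A (c * ‖x - z‖ ^ 2) hm0 ht.ne').deriv
  have h4 : (fun y => φ (y, t)) =
      fun y => A * t⁻¹ ^ m * Real.exp (-(c * ‖y - z‖ ^ 2 * t⁻¹)) := by
    funext y
    simp only [hφ, hv, hgt.self_of_nhds]
  rw [h3, h4] at h1
  exact absurd (h1.trans_lt' h2) (lt_irrefl _)

end LowerBarrier

theorem closedBall_subset_of_lt_infDist_frontier {N : ℕ} {Ω : Set (EuclideanSpace ℝ (Fin N))}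
    (hΩo : IsOpen Ω) {x : EuclideanSpace ℝ (Fin N)} (hx : x ∈ Ω) {R : ℝ} (hR : 0 ≤ R)
    (h : R < infDist x (frontier Ω)) : closedBall x R ⊆ Ω := by
  refine (convex_closedBall x R).isPreconnected.subset_of_closure_inter_subset hΩo
    ⟨x, mem_closedBall_self hR, hx⟩ ?_
  rintro y ⟨hy, hyR⟩
  rcases closure_eq_self_union_frontier Ω ▸ hy with hy | hy
  · exact hy
  · have h1 := infDist_le_dist_of_mem (x := x) hy
    rw [mem_closedBall'] at hyR
    linarith

theorem eventually_log_lt {N : ℕ} (hN : 2 ≤ N) {p : ℝ} (hp : 1 < p)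
    {Ω : Set (EuclideanSpace ℝ (Fin N))} (hΩo : IsOpen Ω)
    {u : EuclideanSpace ℝ (Fin N) → ℝ → ℝ} (hu : IsSolP p Ω u)
    (hupos : ∀ x ∈ Ω, ∀ t : ℝ, 0 < t → 0 < u x t ∧ u x t < 1)
    {x : EuclideanSpace ℝ (Fin N)} (hx : x ∈ Ω) {q b : ℝ} (hq : 0 < q)
    (hqd : q < infDist x (frontier Ω)) (hb : -(p / (p - 1)) * q ^ 2 < b) :
    ∀ᶠ t in 𝓝[>] (0 : ℝ), 4 * t * Real.log (u x t) < b := by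
  have hp1 : 0 < p - 1 := by linarith
  have hp0 : 0 < p := by linarith
  obtain ⟨R, hqR, hRd⟩ := exists_between hqd
  have hball := closedBall_subset_of_lt_infDist_frontier hΩo hx (by linarith) hRd
  set C := (N + p - 2) / (p * (R - q)) with hC
  have hlim : Tendsto (fun t : ℝ => -(p / (p - 1)) * q ^ 2 + 2 * (p / (p - 1)) * q * C * t +
      4 * t ^ 2) (𝓝[>] 0) (𝓝 (-(p / (p - 1)) * q ^ 2)) := by
    refine tendsto_nhdsWithin_of_tendsto_nhds ?_
    have h : Continuous fun t : ℝ => -(p / (p - 1)) * q ^ 2 + 2 * (p / (p - 1)) * q * C * t +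
      4 * t ^ 2 := by fun_prop
    simpa using h.tendsto 0
  filter_upwards [hlim.eventually (gt_mem_nhds hb), self_mem_nhdsWithin] with t htb ht
  have ht : 0 < t := ht
  refine lt_of_le_of_lt ?_ htb
  have h := le_exp_barrier hN hp hΩo hu (fun x hx t ht => (hupos x hx t ht).2) (R := R)
    (δ := R - q) (k := p / (p - 1) * q / (2 * t)) (by linarith) (by linarith) (by positivity)
    hball ht
  have h1 := (Real.log_le_iff_le_exp (hupos x hx t ht).1).2 h
  have h2 := mul_le_mul_of_nonneg_left h1 (by positivity : 0 ≤ 4 * t)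
  refine h2.trans_eq ?_
  rw [← hC]
  field_simp
  ring

theorem eventually_lt_log {N : ℕ} {p : ℝ} (hp : 1 < p)
    {Ω : Set (EuclideanSpace ℝ (Fin N))}
    {u : EuclideanSpace ℝ (Fin N) → ℝ → ℝ} (hu : IsSolP p Ω u)
    (hpos : ∀ x ∈ Ω, ∀ t : ℝ, 0 < t → 0 < u x t)
    {x z : EuclideanSpace ℝ (Fin N)} (hx : x ∈ Ω) (hz : z ∉ closure Ω) {b : ℝ}
    (hb : b < -(p / (p - 1)) * dist x z ^ 2) :
    ∀ᶠ t in 𝓝[>] (0 : ℝ), b < 4 * t * Real.log (u x t) := by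
  have hp1 : 0 < p - 1 := by linarith
  obtain ⟨ρ, hρ, hball⟩ := Metric.isOpen_iff.1 isClosed_closure.isOpen_compl z hz
  have hfar : ∀ y ∈ closure Ω, ρ ≤ ‖y - z‖ := fun y hy => by
    by_contra! h
    exact hball (mem_ball_iff_norm.2 h) hy
  obtain ⟨m, hm⟩ := exists_nat_gt (max 0 ((N + p - 2) / (2 * (p - 1))))
  have hm0 : m ≠ 0 := by
    rintro rfl
    simpa using (le_max_left _ _).trans_lt hm
  obtain ⟨A, hA, hle⟩ := exists_gaussian_le hp hu hpos hρ hfar hm0 ((le_max_right _ _).trans_lt hm)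
  have hlim : Tendsto (fun t : ℝ => 4 * t * Real.log A + -(p / (p - 1)) * dist x z ^ 2)
      (𝓝[>] 0) (𝓝 (-(p / (p - 1)) * dist x z ^ 2)) := by
    refine tendsto_nhdsWithin_of_tendsto_nhds ?_
    have h : Continuous fun t : ℝ => 4 * t * Real.log A + -(p / (p - 1)) * dist x z ^ 2 := by
      fun_prop
    simpa using h.tendsto 0
  filter_upwards [hlim.eventually (lt_mem_nhds hb), Ioo_mem_nhdsGT one_pos] with t htb ht
  obtain ⟨ht, ht1⟩ := ht
  refine htb.trans_le ?_
  have h1 : A * 1 * Real.exp (-(p / (p - 1) / 4 * ‖x - z‖ ^ 2 * t⁻¹)) ≤ u x t := by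
    refine le_trans ?_ (hle x hx t ht)
    have : 1 ≤ t⁻¹ ^ m := one_le_pow₀ ((one_le_inv₀ ht).2 ht1.le)
    gcongr
  have h2 := Real.log_le_log (by positivity) h1
  rw [mul_one, Real.log_mul hA.ne' (Real.exp_ne_zero _), Real.log_exp, ← dist_eq_norm] at h2
  refine le_trans (le_of_eq ?_) (mul_le_mul_of_nonneg_left h2 (by positivity : 0 ≤ 4 * t))
  field_simp

/-- Varadhan-type formula: `4t log u(x,t) → −p' d_Γ(x)²` as `t → 0⁺`,
for every `x ∈ Ω̄`, when `Γ = ∂(ℝ^N \ Ω̄)`. -/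
theorem stmt9 (N : ℕ) (hN : 2 ≤ N) (p : ℝ) (hp : 1 < p)
    (Ω : Set (EuclideanSpace ℝ (Fin N))) (hΩo : IsOpen Ω) (hΩc : IsConnected Ω)
    (hΓ : (frontier Ω).Nonempty)
    (hΓ' : frontier Ω = frontier ((closure Ω)ᶜ))
    (u : EuclideanSpace ℝ (Fin N) → ℝ → ℝ) (hu : IsSolP p Ω u)
    (hupos : ∀ x ∈ Ω, ∀ t : ℝ, 0 < t → 0 < u x t ∧ u x t < 1) :
    ∀ x ∈ closure Ω,
      Filter.Tendsto (fun t : ℝ => 4 * t * Real.log (u x t)) (𝓝[>] (0:ℝ))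
        (𝓝 (-(p/(p-1)) * (Metric.infDist x (frontier Ω))^2)) := by
  intro x hxcl
  have hp1 : 0 < p - 1 := by linarith
  have hc : 0 < p / (p - 1) := div_pos (by linarith) hp1
  rcases closure_eq_self_union_frontier Ω ▸ hxcl with hx | hx
  · have hd : 0 < infDist x (frontier Ω) :=
      (isClosed_frontier.notMem_iff_infDist_pos hΓ).1 fun h =>
        (hΩo.inter_frontier_eq.le ⟨hx, h⟩ : x ∈ (∅ : Set _))
    set d := infDist x (frontier Ω) with hd_def
    have hcts : Continuous fun q : ℝ => -(p / (p - 1)) * q ^ 2 := by fun_prop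
    refine tendsto_order.2 ⟨fun b hb => ?_, fun b hb => ?_⟩
    · obtain ⟨ε, hε, hεb⟩ := Metric.eventually_nhds_iff.1
        (hcts.continuousAt.eventually (lt_mem_nhds hb))
      obtain ⟨y, hy, hxy⟩ := (infDist_lt_iff hΓ).1 (lt_add_of_pos_right d (half_pos hε))
      obtain ⟨z, hz, hyz⟩ := Metric.mem_closure_iff.1
        (frontier_subset_closure (hΓ' ▸ hy)) (ε / 2) (half_pos hε)
      refine eventually_lt_log hp hu (fun x hx t ht => (hupos x hx t ht).1) hx hz ?_
      refine (hεb (y := d + ε / 2 + dist y z) ?_).trans_le ?_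
      · rw [Real.dist_eq, abs_lt]
        constructor <;> linarith [dist_nonneg (x := y) (y := z)]
      · have h1 : dist x z ≤ d + ε / 2 + dist y z := (dist_triangle x y z).trans (by linarith)
        have h2 := pow_le_pow_left₀ dist_nonneg h1 2
        nlinarith
    · obtain ⟨ε, hε, hεb⟩ := Metric.eventually_nhds_iff.1
        (hcts.continuousAt.eventually (gt_mem_nhds hb))
      obtain ⟨q, hq1, hq2⟩ := exists_between (max_lt hd (sub_lt_self d hε))
      have hq0 := (le_max_left _ _).trans_lt hq1
      have hqε := (le_max_right _ _).trans_lt hq1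
      refine eventually_log_lt hN hp hΩo hu hupos hx hq0 hq2 (hεb ?_)
      rw [Real.dist_eq, abs_lt]
      constructor <;> linarith
  · rw [infDist_zero_of_mem hx]
    refine tendsto_nhds_of_eventually_eq ?_
    filter_upwards [self_mem_nhdsWithin] with t ht
    simp [hu.2.2.2.2 x hx t ht]

end
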